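/- For z, ω₁, ..., ω_r in the upper half-plane, the analytic continuation of the bilateral zeta function ξ_{r+1}(s, z | e^{πi}; ω₁,...,ω_r) vanishes at s = 1 − m for every positive integer m, and its s-derivative there equals ((m−1)!/(2πi)^{m−1}) · Σ_{n≥1} e^{2πinz} / (n^m ∏_{j=1}^r (1 − e^{2πinω_j})). -/

import Mathlib

open Complex Real

/-- The Barnes multiple zeta series (principal-branch powers). -/
noncomputable def barnesZeta (r : ℕ) (s z : ℂ) (ω : Fin r → ℂ) : ℂ :=
  ∑' m : Fin r → ℕ, (z + ∑ j, (m j : ℂ) * ω j) ^ (-s)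

/-- The bilateral multiple zeta series `ξ_{r+1}(s, z | e^{πi}; ω)`, where
`e^{πi} = -1` (with principal argument `π`) and `-e^{πi} = 1`:
`ξ_{r+1}(s,z|e^{πi};ω) = ζ_{r+1}(s, z + e^{πi} | e^{πi}, ω) + ζ_{r+1}(s, z | 1, ω)`. -/
noncomputable def xiSeries (r : ℕ) (s z : ℂ) (ω : Fin r → ℂ) : ℂ :=
  barnesZeta (r + 1) s (z + (-1)) (Fin.cons (-1) ω)
    + barnesZeta (r + 1) s z (Fin.cons 1 ω)

section BilateralZeta

open MeasureTheory ProbabilityTheory Set Filter Topology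

/-- Euler's integral for the Gamma function with a complex scale in the right half-plane. -/
theorem integral_rpow_mul_cexp_neg_mul_Ioi {s : ℝ} (hs : 0 < s) {w : ℂ} (hw : 0 < w.re) :
    ∫ t in Ioi (0 : ℝ), ((t ^ (s - 1) : ℝ) : ℂ) * Complex.exp (-(w * t)) =
      w ^ (-(s : ℂ)) * Complex.Gamma s := by
  set ρ : ℝ → NNReal := fun t => Real.toNNReal (t ^ (s - 1)) with hρ
  have hρm : Measurable ρ := by fun_prop
  set μ : Measure ℝ := (volume.restrict (Ioi 0)).withDensity (fun t => (ρ t : ENNReal)) with hμ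
  have hsub : Iio (0 : ℝ) ⊆ integrableExpSet id μ := by
    intro t ht
    rw [mem_Iio] at ht
    simp only [integrableExpSet, mem_ofPred_eq, hμ, id]
    rw [integrable_withDensity_iff_integrable_coe_smul hρm]
    have := integrableOn_rpow_mul_exp_neg_mul_rpow (p := 1) (s := s - 1) (b := -t)
      (by linarith) one_pos (by linarith)
    refine IntegrableOn.congr_fun this (fun x hx => ?_) measurableSet_Ioi
    have hx' : (0 : ℝ) ≤ x ^ (s - 1) := Real.rpow_nonneg (le_of_lt hx) _
    simp [hρ, Real.coe_toNNReal _ hx']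
  have key : ∀ z : ℂ, complexMGF id μ (-z) =
      ∫ t in Ioi (0 : ℝ), ((t ^ (s - 1) : ℝ) : ℂ) * Complex.exp (-(z * t)) := by
    intro z
    simp only [complexMGF, hμ, id]
    rw [integral_withDensity_eq_integral_smul hρm]
    refine setIntegral_congr_fun measurableSet_Ioi (fun x hx => ?_)
    have hx' : (0 : ℝ) ≤ x ^ (s - 1) := Real.rpow_nonneg (le_of_lt hx) _
    simp [hρ, NNReal.smul_def, Real.coe_toNNReal _ hx']
  have hopen : IsOpen {z : ℂ | 0 < z.re} := isOpen_lt continuous_const Complex.continuous_re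
  have h1 : AnalyticOnNhd ℂ (fun z => complexMGF id μ (-z)) {z : ℂ | 0 < z.re} := by
    refine DifferentiableOn.analyticOnNhd ?_ hopen
    refine differentiableOn_complexMGF.comp (differentiable_neg.differentiableOn) ?_
    intro z hz
    simp only [mem_ofPred_eq] at hz ⊢
    refine interior_mono hsub ?_
    rw [interior_Iio]
    simpa using hz
  have h2 : AnalyticOnNhd ℂ (fun z : ℂ => z ^ (-(s : ℂ)) * Complex.Gamma s)
      {z : ℂ | 0 < z.re} := by
    refine DifferentiableOn.analyticOnNhd ?_ hopen
    intro z hz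
    refine DifferentiableAt.differentiableWithinAt ?_
    exact (DifferentiableAt.cpow_const differentiableAt_id (Or.inl hz)).mul_const _
  have hconn : IsPreconnected {z : ℂ | 0 < z.re} :=
    (convex_halfSpace_re_gt 0).isPreconnected
  rw [← key w]
  refine h1.eqOn_of_preconnected_of_frequently_eq h2 hconn (z₀ := 1) (by simp) ?_ hw
  have hlim : Tendsto (fun x : ℝ => (x : ℂ)) (𝓝[>] 1) (𝓝[≠] 1) := by
    refine tendsto_nhdsWithin_iff.2 ⟨?_, ?_⟩
    · exact (Complex.continuous_ofReal.tendsto' 1 1 (by simp)).mono_left nhdsWithin_le_nhds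
    · filter_upwards [self_mem_nhdsWithin] with x hx
      simp only [mem_Ioi] at hx
      simp only [mem_compl_iff, mem_singleton_iff]
      exact_mod_cast hx.ne'
  refine hlim.frequently (Eventually.frequently ?_)
  filter_upwards [self_mem_nhdsWithin] with x hx
  have hx0 : (0 : ℝ) < x := lt_trans one_pos hx
  rw [key]
  have := Complex.integral_cpow_mul_exp_neg_mul_Ioi (a := s) (r := x) (by simpa using hs) hx0
  rw [one_div, Complex.inv_cpow_ofReal_nonneg hx0.le, ← Complex.cpow_neg] at this
  rw [← this]
  refine setIntegral_congr_fun measurableSet_Ioi (fun t ht => ?_)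
  rw [Complex.ofReal_cpow (le_of_lt ht)]
  push_cast
  rfl

theorem neg_two_pi_I_mul_cpow_neg (s : ℂ) {u : ℂ} (hu : 0 < u.im) :
    (-(2 * π * I * u)) ^ (-s) =
      Complex.exp (π * I * s / 2) * (2 * π : ℂ) ^ (-s) * u ^ (-s) := by
  have hu0 : u ≠ 0 := by rintro rfl; simp at hu
  have hI : -I * u ≠ 0 := mul_ne_zero (neg_ne_zero.2 I_ne_zero) hu0
  have h2π : (0 : ℝ) < 2 * π := by positivity
  have hlog : Complex.log (-I * u) = Complex.log (-I) + Complex.log u := by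
    rw [Complex.log_mul_eq_add_log_iff (neg_ne_zero.2 I_ne_zero) hu0, arg_neg_I]
    have h1 := Complex.arg_nonneg_iff.2 hu.le
    have h2 := Complex.arg_le_pi u
    constructor <;> linarith [Real.pi_pos]
  have hfac : -(2 * π * I * u) = ((2 * π : ℝ) : ℂ) * (-I * u) := by push_cast; ring
  have hpos : (2 * π : ℂ) = ((2 * π : ℝ) : ℂ) := by push_cast; ring
  rw [hfac, hpos, cpow_def_of_ne_zero (mul_ne_zero (by exact_mod_cast h2π.ne') hI),
    cpow_def_of_ne_zero (by exact_mod_cast h2π.ne'), cpow_def_of_ne_zero hu0,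
    Complex.log_ofReal_mul h2π hI, hlog, Complex.log_neg_I, ← Complex.ofReal_log h2π.le,
    ← Complex.exp_add, ← Complex.exp_add]
  congr 1
  ring

theorem fourier_max_rpow_mul_cexp {s : ℝ} (hs : 1 < s) {w : ℂ} (hw : 0 < w.im) (ξ : ℝ) :
    FourierTransform.fourier
        (fun x : ℝ => (((max x 0) ^ (s - 1) : ℝ) : ℂ) * Complex.exp (2 * π * I * x * w)) ξ =
      (-(2 * π * I * (w - ξ))) ^ (-(s : ℂ)) * Complex.Gamma s := by
  have hre : 0 < (-(2 * π * I * (w - ξ))).re := by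
    simp
    positivity
  rw [← integral_rpow_mul_cexp_neg_mul_Ioi (by linarith) hre, Real.fourier_real_eq_integral_exp_smul,
    ← integral_indicator measurableSet_Ioi]
  congr 1
  ext x
  by_cases hx : 0 < x
  · rw [indicator_of_mem (mem_Ioi.2 hx), max_eq_left hx.le, smul_eq_mul, mul_left_comm,
      ← Complex.exp_add]
    congr 2
    push_cast
    ring
  · rw [indicator_of_notMem (by simpa using hx), max_eq_right (not_lt.1 hx),
      Real.zero_rpow (by linarith)]
    simp

/-- The Lipschitz summation formula for real exponents. -/
theorem tsum_int_add_cpow_neg {s : ℝ} (hs : 1 < s) {w : ℂ} (hw : 0 < w.im)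
    (hsum : Summable fun n : ℤ => (w + n) ^ (-(s : ℂ))) :
    ∑' n : ℤ, (w + n) ^ (-(s : ℂ)) =
      Complex.exp (-(π * I * s / 2)) * (2 * π : ℂ) ^ (s : ℂ) / Complex.Gamma s *
        ∑' n : ℕ, ((n : ℂ) + 1) ^ ((s : ℂ) - 1) * Complex.exp (2 * π * I * (n + 1) * w) := by
  set f : ℝ → ℂ := fun x => (((max x 0) ^ (s - 1) : ℝ) : ℂ) * Complex.exp (2 * π * I * x * w)
    with hf
  set c : ℂ := Complex.exp (π * I * s / 2) * (2 * π : ℂ) ^ (-(s : ℂ)) with hc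
  have hfourier : ∀ n : ℤ, FourierTransform.fourier f (n : ℝ) =
      c * Complex.Gamma s * (w + ((-n : ℤ) : ℂ)) ^ (-(s : ℂ)) := by
    intro n
    have him : 0 < (w - n).im := by simpa using hw
    rw [hf, fourier_max_rpow_mul_cexp hs hw, hc]
    push_cast
    rw [neg_two_pi_I_mul_cpow_neg _ him, ← sub_eq_add_neg]
    ring
  have hcont : Continuous f := by
    have : Continuous fun x : ℝ => (max x 0) ^ (s - 1) :=
      (continuous_id.max continuous_const).rpow_const (fun _ => Or.inr (by linarith))
    fun_prop
  have hnorm : ∀ x : ℝ, ‖f x‖ = (max x 0) ^ (s - 1) * Real.exp (-(2 * π * w.im) * x) := by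
    intro x
    rw [hf]
    simp only [norm_mul, Complex.norm_exp, Complex.norm_real, Real.norm_eq_abs]
    rw [abs_of_nonneg (Real.rpow_nonneg (le_max_right _ _) _)]
    congr 2
    simp
    ring_nf
  have hdecay : f =O[cocompact ℝ] fun x : ℝ => |x| ^ (-(2 : ℝ)) := by
    rw [cocompact_eq_atBot_atTop, Asymptotics.isBigO_sup]
    constructor
    · refine Asymptotics.IsBigO.congr' (Asymptotics.isBigO_zero _ _) ?_ EventuallyEq.rfl
      filter_upwards [eventually_le_atBot 0] with x hx
      rw [hf]
      simp [max_eq_right hx, Real.zero_rpow (show s - 1 ≠ 0 by linarith)]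
    · have h := (isLittleO_exp_neg_mul_rpow_atTop (a := 2 * π * w.im) (by positivity)
        (-2 - (s - 1))).isBigO
      have h2 := (Asymptotics.isBigO_refl (fun x : ℝ => x ^ (s - 1)) atTop).mul h
      rw [← Asymptotics.isBigO_norm_left]
      refine h2.congr' ?_ ?_
      · filter_upwards [eventually_ge_atTop 0] with x hx
        rw [hnorm, max_eq_left hx]
      · filter_upwards [eventually_gt_atTop 0] with x hx
        rw [← Real.rpow_add hx, abs_of_pos hx]
        congr 1
        ring
  have hsumneg : Summable fun n : ℤ => (w + ((-n : ℤ) : ℂ)) ^ (-(s : ℂ)) :=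
    (Equiv.neg ℤ).summable_iff.2 hsum
  have hpoisson := Real.tsum_eq_tsum_fourier_of_rpow_decay_of_summable hcont one_lt_two hdecay
    (by simp_rw [hfourier]; exact hsumneg.mul_left _) 0
  have hc0 : c * (Complex.exp (-(π * I * s / 2)) * (2 * π : ℂ) ^ (s : ℂ)) = 1 := by
    have h2π : (2 * π : ℂ) ≠ 0 := by simp [Real.pi_ne_zero]
    rw [hc, mul_mul_mul_comm, ← Complex.exp_add, ← Complex.cpow_add _ _ h2π]
    simp
  have hΓ : Complex.Gamma s ≠ 0 := Complex.Gamma_ne_zero_of_re_pos (by simp; linarith)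
  have hleft : ∑' n : ℤ, f (0 + n) =
      ∑' n : ℕ, ((n : ℂ) + 1) ^ ((s : ℂ) - 1) * Complex.exp (2 * π * I * (n + 1) * w) := by
    have hinj : Function.Injective (fun n : ℕ => (n : ℤ) + 1) := fun a b h => by simpa using h
    rw [← hinj.tsum_eq (f := fun n : ℤ => f (0 + n))]
    · refine tsum_congr fun n => ?_
      have : (0 : ℝ) ≤ (n : ℝ) + 1 := by positivity
      rw [hf]
      simp only [zero_add, Int.cast_add, Int.cast_natCast, Int.cast_one]
      rw [max_eq_left this, Complex.ofReal_cpow this]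
      push_cast
      rfl
    · intro n hn
      by_contra hcon
      refine hn ?_
      have hn0 : n ≤ 0 := by
        by_contra hpos
        exact hcon ⟨(n - 1).toNat, by simp; omega⟩
      have hn1 : (n : ℝ) ≤ 0 := by exact_mod_cast hn0
      rw [hf]
      simp [max_eq_right hn1, Real.zero_rpow (show s - 1 ≠ 0 by linarith)]
  have hright : ∑' n : ℤ, FourierTransform.fourier f (n : ℝ) * fourier n ((0 : ℝ) : UnitAddCircle) =
      c * Complex.Gamma s * ∑' n : ℤ, (w + n) ^ (-(s : ℂ)) := by
    rw [← (Equiv.neg ℤ).tsum_eq (fun n : ℤ => (w + n) ^ (-(s : ℂ))), ← tsum_mul_left]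
    refine tsum_congr fun n => ?_
    rw [hfourier]
    simp
  rw [hleft, hright] at hpoisson
  rw [hpoisson, div_mul_eq_mul_div, eq_div_iff hΓ]
  linear_combination (-(Complex.Gamma s * ∑' n : ℤ, (w + n) ^ (-(s : ℂ)))) * hc0

theorem summable_norm_pi_prod_and_tsum {r : ℕ} (f : Fin r → ℕ → ℂ)
    (hf : ∀ j, Summable fun n => ‖f j n‖) :
    (Summable fun m : Fin r → ℕ => ‖∏ j, f j (m j)‖) ∧
      ∑' m : Fin r → ℕ, ∏ j, f j (m j) = ∏ j, ∑' n, f j n := by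
  induction r with
  | zero =>
    exact ⟨(hasSum_fintype _).summable, by simp [tsum_fintype]⟩
  | succ r ih =>
    obtain ⟨h1, h2⟩ := ih (fun j => f j.succ) (fun j => hf _)
    have hcongr (p : ℕ × (Fin r → ℕ)) :
        ∏ j, f j ((Fin.cons p.1 p.2 : Fin (r + 1) → ℕ) j) =
          f 0 p.1 * ∏ j : Fin r, f j.succ (p.2 j) := by
      rw [Fin.prod_univ_succ]
      rfl
    constructor
    · rw [← (Fin.consEquiv (fun _ => ℕ)).summable_iff]
      exact ((hf 0).mul_norm h1).congr fun p => congrArg norm (hcongr p).symm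
    · rw [← (Fin.consEquiv (fun _ => ℕ)).tsum_eq, Fin.prod_univ_succ, ← h2,
        tsum_mul_tsum_of_summable_norm (hf 0) h1]
      exact tsum_congr hcongr

theorem exists_pos_mul_le_norm_add_sum {r : ℕ} {z : ℂ} {ω : Fin r → ℂ}
    (hz : 0 < z.im) (hω : ∀ j, 0 < (ω j).im) :
    ∃ c : ℝ, 0 < c ∧ ∀ (n : ℤ) (m : Fin r → ℕ),
      c * (1 + |(n : ℝ)| + ∑ j, (m j : ℝ)) ≤ ‖z + ∑ j, (m j : ℂ) * ω j + n‖ := by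
  obtain ⟨a, ha, haz, haω⟩ : ∃ a : ℝ, 0 < a ∧ a ≤ z.im ∧ ∀ j, a ≤ (ω j).im := by
    obtain ⟨x, hx⟩ := Finite.exists_max (fun o : Option (Fin r) => -(o.elim z.im fun j => (ω j).im))
    refine ⟨x.elim z.im fun j => (ω j).im, ?_, ?_, fun j => ?_⟩
    · cases x
      · exact hz
      · exact hω _
    · simpa using hx none
    · simpa using hx (some j)
  obtain ⟨B, hB, hBz, hBω⟩ : ∃ B : ℝ, 0 < B ∧ ‖z‖ ≤ B ∧ ∀ j, ‖ω j‖ ≤ B := by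
    refine ⟨1 + ‖z‖ + ∑ j, ‖ω j‖, by positivity, ?_, fun j => ?_⟩
    · linarith [Finset.sum_nonneg fun (j : Fin r) (_ : j ∈ Finset.univ) => norm_nonneg (ω j)]
    · linarith [Finset.single_le_sum (fun (j : Fin r) _ => norm_nonneg (ω j)) (Finset.mem_univ j),
        norm_nonneg z]
  refine ⟨a / (1 + a + B), by positivity, fun n m => ?_⟩
  set S : ℝ := ∑ j, (m j : ℝ) with hS
  set v : ℂ := z + ∑ j, (m j : ℂ) * ω j with hv
  have him : a * (1 + S) ≤ (v + n).im := by
    have : (v + n).im = z.im + ∑ j, (m j : ℝ) * (ω j).im := by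
      simp [hv, Complex.im_sum]
    rw [this, mul_add, hS, Finset.mul_sum, mul_one]
    refine add_le_add haz (Finset.sum_le_sum fun j _ => ?_)
    rw [mul_comm]
    exact mul_le_mul_of_nonneg_left (haω j) (by positivity)
  have hvB : ‖v‖ ≤ B * (1 + S) := by
    rw [mul_add, hS, Finset.mul_sum, mul_one]
    refine (norm_add_le _ _).trans (add_le_add hBz ((norm_sum_le _ _).trans
      (Finset.sum_le_sum fun j _ => ?_)))
    rw [norm_mul, Complex.norm_natCast, mul_comm]
    exact mul_le_mul_of_nonneg_right (hBω j) (by positivity)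
  have h1 : a * (1 + S) ≤ ‖v + n‖ := him.trans ((le_abs_self _).trans (Complex.abs_im_le_norm _))
  have h2 : |(n : ℝ)| ≤ ‖v + n‖ + ‖v‖ := by
    have : ‖(n : ℂ)‖ ≤ ‖v + n‖ + ‖v‖ := by
      simpa using norm_sub_le (v + n) v
    simpa [Complex.norm_intCast] using this
  rw [div_mul_eq_mul_div, div_le_iff₀ (by positivity)]
  nlinarith [mul_le_mul_of_nonneg_left h1 hB.le, mul_le_mul_of_nonneg_left h2 ha.le,
    mul_le_mul_of_nonneg_left hvB ha.le]

theorem summable_add_sum_add_int_cpow {r : ℕ} {z : ℂ} {ω : Fin r → ℂ}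
    (hz : 0 < z.im) (hω : ∀ j, 0 < (ω j).im) {s : ℝ} (hs : 2 * ((r : ℝ) + 1) ≤ s) :
    Summable fun p : ℤ × (Fin r → ℕ) => (z + ∑ j, (p.2 j : ℂ) * ω j + p.1) ^ (-(s : ℂ)) := by
  obtain ⟨c, hc, hbound⟩ := exists_pos_mul_le_norm_add_sum hz hω
  have hnat : Summable fun n : ℕ => ‖((((1 + (n : ℝ)) ^ 2)⁻¹ : ℝ) : ℂ)‖ := by
    have := (summable_nat_add_iff 1).2 (Real.summable_nat_pow_inv.2 one_lt_two)
    refine this.congr fun n => ?_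
    rw [Complex.norm_real, Real.norm_of_nonneg (by positivity)]
    push_cast
    rw [add_comm]
  have hint : Summable fun n : ℤ => ((1 + |(n : ℝ)|) ^ 2)⁻¹ := by
    refine Summable.of_nat_of_neg_add_one ?_ ?_
    · refine hnat.congr fun n => ?_
      rw [Complex.norm_real, Real.norm_of_nonneg (by positivity)]
      simp
    · refine ((summable_nat_add_iff 1).2 hnat).congr fun n => ?_
      rw [Complex.norm_real, Real.norm_of_nonneg (by positivity)]
      push_cast
      rw [abs_neg, abs_of_nonneg (by positivity : (0 : ℝ) ≤ (n : ℝ) + 1)]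
  have hpi := (summable_norm_pi_prod_and_tsum
    (fun (_ : Fin r) (n : ℕ) => ((((1 + (n : ℝ)) ^ 2)⁻¹ : ℝ) : ℂ)) (fun _ => hnat)).1
  have hprod := ((hint.mul_of_nonneg hpi (fun n => by positivity)
    (fun m => norm_nonneg _)).mul_left (c ^ (-s)))
  refine Summable.of_norm_bounded hprod fun p => ?_
  obtain ⟨n, m⟩ := p
  simp only
  set S : ℝ := ∑ j, (m j : ℝ) with hS
  have hS0 : 0 ≤ S := Finset.sum_nonneg fun _ _ => by positivity
  set T : ℝ := 1 + |(n : ℝ)| + S with hT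
  have hT1 : 1 ≤ T := by linarith [abs_nonneg (n : ℝ)]
  have hb := hbound n m
  have hpos : 0 < ‖z + ∑ j, (m j : ℂ) * ω j + n‖ :=
    lt_of_lt_of_le (mul_pos hc (by linarith)) hb
  have hnorm : ‖(z + ∑ j, (m j : ℂ) * ω j + n) ^ (-(s : ℂ))‖ =
      ‖z + ∑ j, (m j : ℂ) * ω j + n‖ ^ (-s) := by
    rw [← Complex.ofReal_neg, Complex.norm_cpow_real]
  have hs0 : -s ≤ 0 := by
    have : (0 : ℝ) ≤ r := by positivity
    linarith
  have hprodT : (1 + |(n : ℝ)|) ^ 2 * ∏ j, (1 + (m j : ℝ)) ^ 2 ≤ T ^ s := by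
    have h1 : (1 + |(n : ℝ)|) ^ 2 ≤ T ^ 2 := by
      gcongr
      linarith
    have h2 : ∏ j, (1 + (m j : ℝ)) ^ 2 ≤ (T ^ 2) ^ r := by
      have : ∀ j ∈ Finset.univ, (1 + (m j : ℝ)) ^ 2 ≤ T ^ 2 := fun j hj => by
        have hj' := Finset.single_le_sum (f := fun j => (m j : ℝ)) (fun _ _ => by positivity) hj
        have : (m j : ℝ) ≤ S := hj'
        gcongr
        linarith [abs_nonneg (n : ℝ)]
      simpa using Finset.prod_le_prod (fun _ _ => by positivity) this
    calc _ ≤ T ^ 2 * (T ^ 2) ^ r := by gcongr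
      _ = T ^ (2 * ((r : ℝ) + 1)) := by
        rw [← pow_succ', ← pow_mul, ← Real.rpow_natCast]
        push_cast
        rfl
      _ ≤ T ^ s := Real.rpow_le_rpow_of_exponent_le hT1 hs
  rw [hnorm]
  calc _ ≤ (c * T) ^ (-s) := Real.rpow_le_rpow_of_nonpos (by positivity) hb hs0
    _ = c ^ (-s) * (T ^ s)⁻¹ := by
      rw [Real.mul_rpow hc.le (by linarith), Real.rpow_neg (by linarith : 0 ≤ T)]
    _ ≤ c ^ (-s) * ((1 + |(n : ℝ)|) ^ 2 * ∏ j, (1 + (m j : ℝ)) ^ 2)⁻¹ := by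
      gcongr
    _ = _ := by
      congr 1
      rw [mul_inv, norm_prod, ← Finset.prod_inv_distrib]
      congr 1
      refine Finset.prod_congr rfl fun j _ => ?_
      rw [Complex.norm_real, Real.norm_of_nonneg (by positivity)]

/-- The derivative of `1 / Γ` at a nonpositive integer. -/
theorem hasDerivAt_Gamma_inv_neg_nat (k : ℕ) :
    HasDerivAt (fun s : ℂ => (Complex.Gamma s)⁻¹) ((-1) ^ k * (k.factorial : ℂ)) (-(k : ℂ)) := by
  have hfun : (fun s : ℂ => (Complex.Gamma s)⁻¹) = fun s => s * (Complex.Gamma (s + 1))⁻¹ :=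
    funext Complex.one_div_Gamma_eq_self_mul_one_div_Gamma_add_one
  induction k with
  | zero =>
    rw [hfun]
    have h := ((Complex.differentiable_one_div_Gamma (0 + 1)).hasDerivAt).comp_add_const 0 1
    simpa using (hasDerivAt_id' (0 : ℂ)).fun_mul h
  | succ k ih =>
    rw [hfun]
    have hk : -((k + 1 : ℕ) : ℂ) + 1 = -(k : ℂ) := by push_cast; ring
    rw [← hk] at ih
    have h := (hasDerivAt_id' (-((k + 1 : ℕ) : ℂ))).fun_mul
      (HasDerivAt.comp_add_const (-((k + 1 : ℕ) : ℂ)) 1 ih)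
    refine h.congr_deriv ?_
    rw [hk, Complex.Gamma_neg_nat_eq_zero, Nat.factorial_succ]
    push_cast
    ring

theorem summable_add_one_rpow_mul_exp_neg (p : ℝ) {y : ℝ} (hy : 0 < y) :
    Summable fun n : ℕ => ((n : ℝ) + 1) ^ p * Real.exp (-y * ((n : ℝ) + 1)) := by
  have h := (summable_nat_add_iff 1).2 (Real.summable_pow_mul_exp_neg_nat_mul ⌈p⌉₊ hy)
  refine Summable.of_nonneg_of_le (fun n => by positivity) (fun n => ?_) h
  push_cast
  gcongr
  rw [← Real.rpow_natCast]
  exact Real.rpow_le_rpow_of_exponent_le (by linarith [n.cast_nonneg (α := ℝ)]) (Nat.le_ceil p)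

theorem norm_cexp_two_pi_I_mul (n : ℕ) (w : ℂ) :
    ‖Complex.exp (2 * π * I * ((n : ℂ) + 1) * w)‖ =
      Real.exp (-(2 * π * w.im) * ((n : ℝ) + 1)) := by
  rw [Complex.norm_exp]
  congr 1
  simp
  ring

theorem norm_add_one_cpow (n : ℕ) (s : ℂ) :
    ‖((n : ℂ) + 1) ^ s‖ = ((n : ℝ) + 1) ^ s.re := by
  have h : ((n : ℂ) + 1) = ((n + 1 : ℝ) : ℂ) := by push_cast; ring
  rw [h, Complex.norm_cpow_eq_rpow_re_of_pos (by positivity)]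

theorem norm_cexp_two_pi_I_mul_le {w : ℂ} (hw : 0 < w.im) (n : ℕ) :
    ‖Complex.exp (2 * π * I * ((n : ℂ) + 1) * w)‖ ≤ Real.exp (-(2 * π * w.im)) := by
  rw [norm_cexp_two_pi_I_mul, Real.exp_le_exp]
  have : 0 < 2 * π * w.im := by positivity
  nlinarith [n.cast_nonneg (α := ℝ)]

theorem exp_neg_two_pi_mul_lt_one {y : ℝ} (hy : 0 < y) : Real.exp (-(2 * π * y)) < 1 :=
  Real.exp_lt_one_iff.2 (neg_neg_of_pos (by positivity))

theorem norm_inv_one_sub_cexp_le {w : ℂ} (hw : 0 < w.im) (n : ℕ) :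
    ‖(1 - Complex.exp (2 * π * I * ((n : ℂ) + 1) * w))⁻¹‖ ≤
      (1 - Real.exp (-(2 * π * w.im)))⁻¹ := by
  have h1 := exp_neg_two_pi_mul_lt_one hw
  have h2 := norm_cexp_two_pi_I_mul_le hw n
  have h3 := norm_sub_norm_le 1 (Complex.exp (2 * π * I * ((n : ℂ) + 1) * w))
  rw [norm_one] at h3
  rw [norm_inv]
  exact inv_anti₀ (by linarith) (by linarith)

/-- The `n`-th term of the Fourier expansion of the bilateral zeta function. -/
noncomputable def xiFourierTerm (r : ℕ) (z : ℂ) (ω : Fin r → ℂ) (n : ℕ) (s : ℂ) : ℂ :=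
  ((n : ℂ) + 1) ^ (s - 1) * Complex.exp (2 * π * I * ((n : ℂ) + 1) * z) *
    ∏ j, (1 - Complex.exp (2 * π * I * ((n : ℂ) + 1) * ω j))⁻¹

theorem differentiable_tsum_xiFourierTerm {r : ℕ} {z : ℂ} {ω : Fin r → ℂ}
    (hz : 0 < z.im) (hω : ∀ j, 0 < (ω j).im) :
    Differentiable ℂ fun s => ∑' n, xiFourierTerm r z ω n s := by
  intro s₀
  set R := ‖s₀‖ + 1 with hR
  set C := ∏ j, (1 - Real.exp (-(2 * π * (ω j).im)))⁻¹ with hC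
  have hmem : s₀ ∈ Metric.ball (0 : ℂ) R := by simp [hR]
  refine DifferentiableOn.differentiableAt (s := Metric.ball 0 R) ?_
    (Metric.isOpen_ball.mem_nhds hmem)
  refine differentiableOn_tsum_of_summable_norm
    ((summable_add_one_rpow_mul_exp_neg R (y := 2 * π * z.im) (by positivity)).mul_right C)
    (fun n => ?_) Metric.isOpen_ball (fun n s hs => ?_)
  · have hn : ((n : ℂ) + 1) ≠ 0 := n.cast_add_one_ne_zero
    refine Differentiable.differentiableOn ?_
    unfold xiFourierTerm
    exact ((((differentiable_id.sub_const 1).const_cpow (Or.inl hn)).mul_const _).mul_const _)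
  · have hsR : s.re - 1 ≤ R := by
      have := (Complex.re_le_norm s)
      rw [Metric.mem_ball, dist_zero_right] at hs
      linarith
    rw [xiFourierTerm, norm_mul, norm_mul, norm_cexp_two_pi_I_mul, norm_add_one_cpow, norm_prod]
    gcongr
    · simp
    · simpa using hsR
    · exact Finset.prod_le_prod (fun _ _ => norm_nonneg _)
        fun j _ => norm_inv_one_sub_cexp_le (hω j) n

theorem tsum_tsum_cpow_mul_cexp {r : ℕ} {z : ℂ} {ω : Fin r → ℂ}
    (hz : 0 < z.im) (hω : ∀ j, 0 < (ω j).im) (s : ℂ) :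
    ∑' m : Fin r → ℕ, ∑' n : ℕ, ((n : ℂ) + 1) ^ (s - 1) *
        Complex.exp (2 * π * I * (n + 1) * (z + ∑ j, (m j : ℂ) * ω j)) =
      ∑' n, xiFourierTerm r z ω n s := by
  set q : ℕ → Fin r → ℂ := fun n j => Complex.exp (2 * π * I * ((n : ℂ) + 1) * ω j) with hq
  set a : ℕ → ℂ := fun n => ((n : ℂ) + 1) ^ (s - 1) *
    Complex.exp (2 * π * I * ((n : ℂ) + 1) * z) with ha
  have hterm : ∀ (m : Fin r → ℕ) (n : ℕ), ((n : ℂ) + 1) ^ (s - 1) *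
      Complex.exp (2 * π * I * (n + 1) * (z + ∑ j, (m j : ℂ) * ω j)) =
      a n * ∏ j, q n j ^ m j := by
    intro m n
    simp only [ha, hq, ← Complex.exp_nat_mul, ← Complex.exp_sum]
    rw [mul_assoc (((n : ℂ) + 1) ^ (s - 1)), ← Complex.exp_add, mul_add, Finset.mul_sum]
    congr 3
    exact Finset.sum_congr rfl fun j _ => by ring
  have hq1 : ∀ n j, ‖q n j‖ < 1 := fun n j =>
    (norm_cexp_two_pi_I_mul_le (hω j) n).trans_lt (exp_neg_two_pi_mul_lt_one (hω j))
  have hpi := (summable_norm_pi_prod_and_tsum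
    (fun (j : Fin r) (k : ℕ) => ((Real.exp (-(2 * π * (ω j).im)) : ℝ) : ℂ) ^ k) (fun j => by
      simp only [norm_pow, Complex.norm_real, Real.norm_eq_abs, Real.abs_exp]
      exact summable_geometric_of_lt_one (Real.exp_pos _).le
        (exp_neg_two_pi_mul_lt_one (hω j)))).1
  have hsum : Summable fun p : (Fin r → ℕ) × ℕ => a p.2 * ∏ j, q p.2 j ^ p.1 j := by
    have hA := summable_add_one_rpow_mul_exp_neg ((s - 1).re) (y := 2 * π * z.im) (by positivity)
    refine Summable.of_norm_bounded (hpi.mul_of_nonneg hA (fun _ => norm_nonneg _)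
      (fun n => by positivity)) fun p => ?_
    rw [norm_mul, ha, norm_mul, norm_cexp_two_pi_I_mul, norm_add_one_cpow, mul_comm, norm_prod,
      norm_prod]
    gcongr with j _
    rw [norm_pow, norm_pow, Complex.norm_real, Real.norm_eq_abs, Real.abs_exp]
    gcongr
    exact norm_cexp_two_pi_I_mul_le (hω j) _
  have hcomm : ∑' (m : Fin r → ℕ) (n : ℕ), a n * ∏ j, q n j ^ m j =
      ∑' (n : ℕ) (m : Fin r → ℕ), a n * ∏ j, q n j ^ m j :=
    Summable.tsum_comm (f := fun (n : ℕ) (m : Fin r → ℕ) => a n * ∏ j, q n j ^ m j)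
      ((Equiv.prodComm _ _).summable_iff.1 hsum)
  simp_rw [hterm]
  rw [hcomm]
  refine tsum_congr fun n => ?_
  rw [tsum_mul_left, (summable_norm_pi_prod_and_tsum (fun j k => q n j ^ k) (fun j => by
    simp only [norm_pow]
    exact summable_geometric_of_lt_one (norm_nonneg _) (hq1 n j))).2, xiFourierTerm]
  congr 1
  exact Finset.prod_congr rfl fun j _ => tsum_geometric_of_norm_lt_one (hq1 n j)

theorem xiSeries_eq_tsum_tsum_int {r : ℕ} {s z : ℂ} {ω : Fin r → ℂ}
    (hsum : Summable fun p : ℤ × (Fin r → ℕ) =>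
      (z + ∑ j, (p.2 j : ℂ) * ω j + p.1) ^ (-s)) :
    xiSeries r s z ω =
      ∑' m : Fin r → ℕ, ∑' n : ℤ, (z + ∑ j, (m j : ℂ) * ω j + n) ^ (-s) := by
  have hpos : Function.Injective fun p : ℕ × (Fin r → ℕ) => ((p.1 : ℤ), p.2) := by
    rintro ⟨a, b⟩ ⟨c, d⟩ h
    simpa using h
  have hneg : Function.Injective fun p : ℕ × (Fin r → ℕ) => (-((p.1 : ℤ) + 1), p.2) := by
    rintro ⟨a, b⟩ ⟨c, d⟩ h
    simpa using h
  have h1 := hsum.comp_injective hpos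
  have h2 := hsum.comp_injective hneg
  have hB1 : barnesZeta (r + 1) s z (Fin.cons 1 ω) =
      ∑' n : ℕ, ∑' m : Fin r → ℕ, (z + ∑ j, (m j : ℂ) * ω j + ((n : ℤ) : ℂ)) ^ (-s) := by
    rw [barnesZeta, ← (Fin.consEquiv (fun _ => ℕ)).tsum_eq]
    refine Eq.trans (tsum_congr fun p => ?_) h1.tsum_prod
    simp only [Fin.sum_univ_succ, Fin.consEquiv, Equiv.coe_fn_mk, Fin.cons_zero, Fin.cons_succ,
      Function.comp_apply]
    congr 1
    push_cast
    ring
  have hB2 : barnesZeta (r + 1) s (z + (-1)) (Fin.cons (-1) ω) =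
      ∑' n : ℕ, ∑' m : Fin r → ℕ,
        (z + ∑ j, (m j : ℂ) * ω j + ((-((n : ℤ) + 1) : ℤ) : ℂ)) ^ (-s) := by
    rw [barnesZeta, ← (Fin.consEquiv (fun _ => ℕ)).tsum_eq]
    refine Eq.trans (tsum_congr fun p => ?_) h2.tsum_prod
    simp only [Fin.sum_univ_succ, Fin.consEquiv, Equiv.coe_fn_mk, Fin.cons_zero, Fin.cons_succ,
      Function.comp_apply]
    congr 1
    push_cast
    ring
  have hcomm : ∑' (m : Fin r → ℕ) (n : ℤ), (z + ∑ j, (m j : ℂ) * ω j + n) ^ (-s) =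
      ∑' (n : ℤ) (m : Fin r → ℕ), (z + ∑ j, (m j : ℂ) * ω j + n) ^ (-s) :=
    Summable.tsum_comm
      (f := fun (n : ℤ) (m : Fin r → ℕ) => (z + ∑ j, (m j : ℂ) * ω j + n) ^ (-s)) hsum
  rw [xiSeries, hB1, hB2, add_comm, hcomm]
  have h3 : Summable fun n : ℕ => ∑' m : Fin r → ℕ,
    (z + ∑ j, (m j : ℂ) * ω j + ((n : ℤ) : ℂ)) ^ (-s) := h1.prod
  have h4 : Summable fun n : ℕ => ∑' m : Fin r → ℕ,
    (z + ∑ j, (m j : ℂ) * ω j + ((-((n : ℤ) + 1) : ℤ) : ℂ)) ^ (-s) := h2.prod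
  exact (tsum_of_nat_of_neg_add_one (f := fun n : ℤ => ∑' m : Fin r → ℕ,
    (z + ∑ j, (m j : ℂ) * ω j + n) ^ (-s)) h3 h4).symm

/-- The Fourier expansion of the bilateral zeta series for large real `s`. -/
theorem xiSeries_eq_tsum_xiFourierTerm {r : ℕ} {z : ℂ} {ω : Fin r → ℂ}
    (hz : 0 < z.im) (hω : ∀ j, 0 < (ω j).im) {s : ℝ} (hs : 2 * ((r : ℝ) + 1) ≤ s) :
    xiSeries r s z ω =
      Complex.exp (-(π * I * s / 2)) * (2 * π : ℂ) ^ (s : ℂ) * (Complex.Gamma s)⁻¹ *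
        ∑' n, xiFourierTerm r z ω n s := by
  have hsum := summable_add_sum_add_int_cpow hz hω hs
  rw [xiSeries_eq_tsum_tsum_int hsum, ← tsum_tsum_cpow_mul_cexp hz hω, ← tsum_mul_left]
  refine tsum_congr fun m => ?_
  have him : 0 < (z + ∑ j, (m j : ℂ) * ω j).im := by
    simp only [Complex.add_im, Complex.im_sum]
    have : 0 ≤ ∑ j, ((m j : ℂ) * ω j).im := Finset.sum_nonneg fun j _ => by
      simpa using mul_nonneg (m j).cast_nonneg (hω j).le
    linarith
  have hs1 : 1 < s := by linarith [r.cast_nonneg (α := ℝ)]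
  rw [tsum_int_add_cpow_neg hs1 him (hsum.comp_injective (i := fun n : ℤ => (n, m))
    fun a b h => by simpa using h), div_eq_mul_inv]

theorem cexp_mul_two_pi_cpow_neg_nat (k : ℕ) :
    Complex.exp (-(π * I * (-(k : ℂ)) / 2)) * (2 * π : ℂ) ^ (-(k : ℂ)) * (-1) ^ k =
      1 / (2 * π * I) ^ k := by
  have h2π : (2 * π : ℂ) ≠ 0 := by simp [Real.pi_ne_zero]
  have hexp : Complex.exp (-(π * I * (-(k : ℂ)) / 2)) = I ^ k := by
    rw [show -(π * I * (-(k : ℂ)) / 2) = k * (π / 2 * I) by ring, Complex.exp_nat_mul,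
      Complex.exp_pi_div_two_mul_I]
  rw [hexp, Complex.cpow_neg, Complex.cpow_natCast, one_div, mul_pow _ I, mul_inv, mul_right_comm,
    ← mul_pow, ← inv_pow I, Complex.inv_I, mul_comm]
  simp

end BilateralZeta

/-- For any entire function `F` agreeing with the bilateral zeta series on its domain of
convergence (i.e. the analytic continuation of `ξ_{r+1}(s, z | e^{πi}; ω)`), `F` vanishes
at `s = 1 − m` for every positive integer `m`, and its derivative there equals
`((m−1)!/(2πi)^{m−1}) Σ_{n≥1} e^{2πinz}/(n^m ∏_j (1 − e^{2πinω_j}))`. -/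
theorem xi_continuation_value_and_deriv (r : ℕ) (z : ℂ) (ω : Fin r → ℂ)
    (hz : 0 < z.im) (hω : ∀ j, 0 < (ω j).im)
    (F : ℂ → ℂ) (hF : Differentiable ℂ F)
    (hagree : ∀ s : ℂ, ((r : ℝ) + 1) < s.re → F s = xiSeries r s z ω)
    (m : ℕ) (hm : 1 ≤ m) :
    F (1 - m) = 0 ∧
    deriv F (1 - m)
      = ((m - 1).factorial : ℂ) / (2 * π * I) ^ (m - 1) *
          ∑' n : ℕ, Complex.exp (2 * π * I * ((n : ℂ) + 1) * z)
            / (((n : ℂ) + 1) ^ m * ∏ j, (1 - Complex.exp (2 * π * I * ((n : ℂ) + 1) * ω j))) := by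

  set E : ℂ → ℂ := fun s => Complex.exp (-(π * I * s / 2)) * (2 * π : ℂ) ^ s with hE
  set S : ℂ → ℂ := fun s => ∑' n, xiFourierTerm r z ω n s with hS
  have h2π : (2 * π : ℂ) ≠ 0 := by simp [Real.pi_ne_zero]
  have hEd : Differentiable ℂ E := by
    refine Differentiable.mul (by fun_prop) (differentiable_id.const_cpow (Or.inl h2π))
  have hESd : Differentiable ℂ fun s => E s * S s :=
    hEd.mul (differentiable_tsum_xiFourierTerm hz hω)
  have hGd : Differentiable ℂ fun s => (Complex.Gamma s)⁻¹ * (E s * S s) :=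
    Complex.differentiable_one_div_Gamma.mul hESd
  have hFG : F = fun s => (Complex.Gamma s)⁻¹ * (E s * S s) := by
    set b : ℝ := 2 * ((r : ℝ) + 1) with hb
    refine AnalyticOnNhd.eq_of_frequently_eq (z₀ := (b : ℂ))
      (Complex.analyticOnNhd_univ_iff_differentiable.2 hF)
      (Complex.analyticOnNhd_univ_iff_differentiable.2 hGd) ?_
    have hlim : Filter.Tendsto (fun x : ℝ => (x : ℂ)) (nhdsWithin b (Set.Ioi b))
        (nhdsWithin (b : ℂ) {(b : ℂ)}ᶜ) := by
      refine tendsto_nhdsWithin_iff.2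
        ⟨(Complex.continuous_ofReal.tendsto b).mono_left nhdsWithin_le_nhds, ?_⟩
      filter_upwards [self_mem_nhdsWithin] with x hx
      simpa using (Set.mem_Ioi.1 hx).ne'
    refine hlim.frequently (Filter.Eventually.frequently ?_)
    filter_upwards [self_mem_nhdsWithin] with x hx
    have hx' : b < x := hx
    have hr : (0 : ℝ) ≤ r := r.cast_nonneg
    rw [hagree x (by rw [Complex.ofReal_re]; linarith),
      xiSeries_eq_tsum_xiFourierTerm hz hω hx'.le]
    ring
  obtain ⟨k, rfl⟩ : ∃ k, m = k + 1 := ⟨m - 1, by omega⟩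
  have hk : (1 : ℂ) - ((k + 1 : ℕ) : ℂ) = -(k : ℂ) := by push_cast; ring
  have hΓ : Complex.Gamma (-(k : ℂ)) = 0 := Complex.Gamma_neg_nat_eq_zero k
  rw [hk, hFG]
  refine ⟨by simp [hΓ], ?_⟩
  rw [((hasDerivAt_Gamma_inv_neg_nat k).fun_mul (hESd (-(k : ℂ))).hasDerivAt).deriv, hΓ, inv_zero,
    zero_mul, add_zero, Nat.add_sub_cancel]
  have hSk : S (-(k : ℂ)) = ∑' n : ℕ, Complex.exp (2 * π * I * ((n : ℂ) + 1) * z)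
      / (((n : ℂ) + 1) ^ (k + 1) *
        ∏ j, (1 - Complex.exp (2 * π * I * ((n : ℂ) + 1) * ω j))) := by
    refine tsum_congr fun n => ?_
    have hexp : -(k : ℂ) - 1 = -((k + 1 : ℕ) : ℂ) := by push_cast; ring
    rw [xiFourierTerm, hexp, Complex.cpow_neg, Complex.cpow_natCast, Finset.prod_inv_distrib,
      div_eq_mul_inv, mul_inv]
    ring
  rw [← hSk]
  have := cexp_mul_two_pi_cpow_neg_nat k
  simp only [hE]
  linear_combination ((k.factorial : ℂ) * S (-(k : ℂ))) * this
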